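/- arXiv:0712.1621 — 13 statements merged into one kernel-verified Lean document; each statement's English description precedes it below -/
import Mathlib

section
/- A binary string s produces a track under the rule "3 out of 5 with loss 2" (i.e., there exist indices i < j < k with s i = s j = s k = 1, j - i ≤ 2, k - j ≤ 2, and k - i ≤ 4) if and only if s contains one of the patterns [1,1,1], [1,0,1,1], [1,1,0,1], [1,0,1,0,1] as a contiguous (infix) substring. -/
/-- The four patterns whose presence as a contiguous substring produces a track
under the rule "3 out of 5 with loss 2". -/
def trackPatterns : List (List Bool) :=
  [[true, true, true], [true, false, true, true],
   [true, true, false, true], [true, false, true, false, true]]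

/-- A binary string is non-tracking if it contains none of the tracking patterns
as a contiguous (infix) substring. -/
def NonTracking (s : List Bool) : Prop :=
  ∀ p ∈ trackPatterns, ¬ p <:+: s

/-- `NTr k` is the number of non-tracking binary strings of length `k`. -/
noncomputable def NTr (k : ℕ) : ℕ :=
  Nat.card {s : List Bool // s.length = k ∧ NonTracking s}

/-- A string is initial-loss if each of its first two entries (those that exist) is `0`. -/
def InitialLoss (s : List Bool) : Prop :=
  ∀ (i : ℕ) (h : i < s.length), i < 2 → s[i] = false

/-- The four basic blocks `0`, `001`, `0011`, `00101`. -/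
def basicBlocks : List (List Bool) :=
  [[false], [false, false, true], [false, false, true, true],
   [false, false, true, false, true]]

/-- A list is an infix of `s` iff its entries occur in `s` from some offset on. -/
theorem infix_iff_exists_getElem?_add {α : Type*} {p s : List α} :
    p <:+: s ↔ ∃ n, n + p.length ≤ s.length ∧ ∀ m < p.length, s[n + m]? = p[m]? := by
  rw [List.infix_iff_getElem?]
  refine exists_congr fun n => and_congr (by rw [add_comm]) (forall₂_congr fun m hm => ?_)
  rw [add_comm m n, List.getElem?_eq_getElem hm]

/-- A binary string produces a track under "3 out of 5 with loss 2" (three detections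
at indices `i < j < k` with `j - i ≤ 2`, `k - j ≤ 2`, `k - i ≤ 4`) iff it contains
one of the patterns `111`, `1011`, `1101`, `10101` as a contiguous substring. -/
theorem track_iff_pattern (s : List Bool) :
    (∃ (i j k : ℕ) (hij : i < j) (hjk : j < k) (hk : k < s.length),
        s[i]'(by omega) = true ∧ s[j]'(by omega) = true ∧ s[k]'hk = true ∧
        j - i ≤ 2 ∧ k - j ≤ 2 ∧ k - i ≤ 4) ↔
    ([true, true, true] <:+: s ∨ [true, false, true, true] <:+: s ∨
      [true, true, false, true] <:+: s ∨ [true, false, true, false, true] <:+: s) := by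
  simp only [infix_iff_exists_getElem?_add, List.length_cons, List.length_nil]
  constructor
  · rintro ⟨i, j, k, hij, hjk, hk, hi, hj, hk', hij2, hjk2, -⟩
    obtain rfl | rfl : j = i + 1 ∨ j = i + 2 := by omega
    · obtain rfl | rfl : k = i + 2 ∨ k = i + 3 := by omega
      · exact .inl ⟨i, by omega, fun m hm => by interval_cases m <;> grind⟩
      · cases h : s[i + 2]
        · exact .inr (.inr (.inl ⟨i, by omega, fun m hm => by interval_cases m <;> grind⟩))
        · exact .inl ⟨i, by omega, fun m hm => by interval_cases m <;> grind⟩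
    · cases h : s[i + 1]
      · obtain rfl | rfl : k = i + 3 ∨ k = i + 4 := by omega
        · exact .inr (.inl ⟨i, by omega, fun m hm => by interval_cases m <;> grind⟩)
        · cases h' : s[i + 3]
          · exact .inr (.inr (.inr ⟨i, by omega, fun m hm => by interval_cases m <;> grind⟩))
          · exact .inl ⟨i + 2, by omega, fun m hm => by interval_cases m <;> grind⟩
      · exact .inl ⟨i, by omega, fun m hm => by interval_cases m <;> grind⟩
  · rintro (⟨n, hn, h⟩ | ⟨n, hn, h⟩ | ⟨n, hn, h⟩ | ⟨n, hn, h⟩)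
    · have := h 0; have := h 1; have := h 2
      exact ⟨n, n + 1, n + 2, by omega, by omega, by omega, by grind, by grind, by grind,
        by omega, by omega, by omega⟩
    · have := h 0; have := h 2; have := h 3
      exact ⟨n, n + 2, n + 3, by omega, by omega, by omega, by grind, by grind, by grind,
        by omega, by omega, by omega⟩
    · have := h 0; have := h 1; have := h 3
      exact ⟨n, n + 1, n + 3, by omega, by omega, by omega, by grind, by grind, by grind,
        by omega, by omega, by omega⟩
    · have := h 0; have := h 2; have := h 4
      exact ⟨n, n + 2, n + 4, by omega, by omega, by omega, by grind, by grind, by grind,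
        by omega, by omega, by omega⟩
end

section
/- For every k ≥ 6, NTr(k) = NTr(k-1) + NTr(k-3) + NTr(k-4) + NTr(k-5). -/
theorem nonTracking_cons (a : Bool) (s : List Bool) :
    NonTracking (a :: s) ↔ (∀ p ∈ trackPatterns, ¬ p <+: a :: s) ∧ NonTracking s := by
  simp only [NonTracking, List.infix_cons_iff, not_or]
  exact forall₂_and

theorem nonTracking_false_cons (s : List Bool) :
    NonTracking (false :: s) ↔ NonTracking s := by
  simp [nonTracking_cons, trackPatterns]

theorem nonTracking_one_loss (s : List Bool) :
    NonTracking (true :: false :: false :: s) ↔ NonTracking s := by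
  simp [nonTracking_cons, trackPatterns]

theorem nonTracking_two_loss (s : List Bool) :
    NonTracking (true :: true :: false :: false :: s) ↔ NonTracking s := by
  simp [nonTracking_cons, trackPatterns]

theorem nonTracking_one_gap_one_loss (s : List Bool) :
    NonTracking (true :: false :: true :: false :: false :: s) ↔ NonTracking s := by
  simp [nonTracking_cons, trackPatterns]

/-- The set of non-tracking strings of length `k`. -/
def nonTrackingStrings (k : ℕ) : Set (List Bool) :=
  {s | s.length = k ∧ NonTracking s}

theorem finite_nonTrackingStrings (k : ℕ) : (nonTrackingStrings k).Finite :=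
  (List.finite_length_eq Bool k).subset fun _ hs => hs.1

theorem ncard_nonTrackingStrings (k : ℕ) : (nonTrackingStrings k).ncard = NTr k := rfl

theorem ncard_image_append_nonTrackingStrings (p : List Bool) (k : ℕ) :
    ((p ++ ·) '' nonTrackingStrings k).ncard = NTr k := by
  rw [Set.ncard_image_of_injective _ (List.append_right_injective p), ncard_nonTrackingStrings]

/-- A non-tracking string of length at least five is a non-tracking string preceded by exactly
one of `0`, `100`, `1100`, `10100`. -/
theorem nonTrackingStrings_add_five (n : ℕ) :
    nonTrackingStrings (n + 5) =
      ([false] ++ ·) '' nonTrackingStrings (n + 4) ∪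
      ([true, false, false] ++ ·) '' nonTrackingStrings (n + 2) ∪
      ([true, true, false, false] ++ ·) '' nonTrackingStrings (n + 1) ∪
      ([true, false, true, false, false] ++ ·) '' nonTrackingStrings n := by
  ext s
  constructor
  · rintro ⟨hl, hs⟩
    obtain _ | ⟨a, _ | ⟨b, _ | ⟨c, _ | ⟨d, _ | ⟨e, t⟩⟩⟩⟩⟩ := s <;> simp at hl
    subst hl
    cases a <;> cases b <;> cases c <;> cases d <;> cases e <;>
      simp_all [nonTrackingStrings, nonTracking_cons, trackPatterns]
  · rintro (((⟨t, ⟨hl, ht⟩, rfl⟩ | ⟨t, ⟨hl, ht⟩, rfl⟩) | ⟨t, ⟨hl, ht⟩, rfl⟩) | ⟨t, ⟨hl, ht⟩, rfl⟩) <;>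
      simp_all [nonTrackingStrings, nonTracking_false_cons, nonTracking_one_loss,
        nonTracking_two_loss, nonTracking_one_gap_one_loss]

theorem NTr_add_five (n : ℕ) :
    NTr (n + 5) = NTr (n + 4) + NTr (n + 2) + NTr (n + 1) + NTr n := by
  have hfin (p : List Bool) (k : ℕ) : ((p ++ ·) '' nonTrackingStrings k).Finite :=
    (finite_nonTrackingStrings k).image _
  rw [← ncard_nonTrackingStrings (n + 5), nonTrackingStrings_add_five,
    Set.ncard_union_eq _ (((hfin _ _).union (hfin _ _)).union (hfin _ _)) (hfin _ _),
    Set.ncard_union_eq _ ((hfin _ _).union (hfin _ _)) (hfin _ _),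
    Set.ncard_union_eq _ (hfin _ _) (hfin _ _)]
  · simp only [ncard_image_append_nonTrackingStrings]
  all_goals
    rw [Set.disjoint_left]
    simp +contextual [or_imp, forall_and]

/-- The recurrence for the non-tracking sequence. -/
theorem NTr_recurrence (k : ℕ) (hk : 6 ≤ k) :
    NTr k = NTr (k - 1) + NTr (k - 3) + NTr (k - 4) + NTr (k - 5) := by
  obtain ⟨n, rfl⟩ := Nat.exists_eq_add_of_le' (Nat.le_of_succ_le hk)
  exact NTr_add_five n
end

section
/- Every non-tracking binary string of length at least 5 ends with one of the suffixes [0], [0,0,1], [0,0,1,1], [0,0,1,0,1]. -/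
theorem NonTracking.of_infix {s t : List Bool} (hs : NonTracking s) (hts : t <:+: s) :
    NonTracking t :=
  fun p hp hpt => hs p hp (hpt.trans hts)

theorem nonTracking_suffix_of_five (a b c d e : Bool) (h : NonTracking [a, b, c, d, e]) :
    [false] <:+ [a, b, c, d, e] ∨ [false, false, true] <:+ [a, b, c, d, e] ∨
      [false, false, true, true] <:+ [a, b, c, d, e] ∨
      [false, false, true, false, true] <:+ [a, b, c, d, e] := by
  unfold NonTracking trackPatterns at h
  revert a b c d e
  decide

/-- Every non-tracking string of length at least 5 ends with one of the suffixes
`0`, `001`, `0011`, `00101`. -/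
theorem nonTracking_suffix (s : List Bool) (hlen : 5 ≤ s.length) (hs : NonTracking s) :
    [false] <:+ s ∨ [false, false, true] <:+ s ∨
      [false, false, true, true] <:+ s ∨ [false, false, true, false, true] <:+ s := by
  have hsuf : s.drop (s.length - 5) <:+ s := List.drop_suffix _ _
  have hlen5 : (s.drop (s.length - 5)).length = 5 := by
    rw [List.length_drop]
    omega
  generalize s.drop (s.length - 5) = t at hsuf hlen5
  match t, hlen5 with
  | [a, b, c, d, e], _ =>
    exact (nonTracking_suffix_of_five a b c d e (hs.of_infix hsuf.isInfix)).imp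
      (·.trans hsuf) (Or.imp (·.trans hsuf) (Or.imp (·.trans hsuf) (·.trans hsuf)))
end

section
/- If a non-tracking binary string of length at least 4 ends with the suffix [1,1], then it ends with the suffix [0,0,1,1]. -/
/-- A non-tracking string of length at least 4 ending in `11` must end in `0011`. -/
theorem nonTracking_endsWith_11 (s : List Bool) (hlen : 4 ≤ s.length)
    (hs : NonTracking s) (h : [true, true] <:+ s) :
    [false, false, true, true] <:+ s := by
  obtain ⟨t, rfl⟩ := h
  obtain rfl | ⟨u, b, rfl⟩ := t.eq_nil_or_concat
  · simp at hlen
  obtain rfl | ⟨v, a, rfl⟩ := u.eq_nil_or_concat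
  · simp at hlen
  cases b with
  | true => exact absurd ⟨v ++ [a], [], by simp⟩ (hs [true, true, true] (by simp [trackPatterns]))
  | false =>
    cases a with
    | true => exact absurd ⟨v, [], by simp⟩ (hs [true, false, true, true] (by simp [trackPatterns]))
    | false => exact ⟨v, by simp⟩
end

section
/- If a non-tracking binary string of length at least 5 ends with the suffix [1,0,1], then it ends with the suffix [0,0,1,0,1]. -/
/-- A non-tracking string of length at least 5 ending in `101` must end in `00101`. -/
theorem nonTracking_endsWith_101 (s : List Bool) (hlen : 5 ≤ s.length)
    (hs : NonTracking s) (h : [true, false, true] <:+ s) :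
    [false, false, true, false, true] <:+ s := by
  obtain ⟨t, rfl⟩ := h
  obtain ⟨r, a, b, rfl⟩ : ∃ r a b, t = r ++ [a, b] := by
    have ht : 2 ≤ t.length := by simpa using hlen
    induction t using List.reverseRecOn with
    | nil => simp at ht
    | append_singleton t b _ =>
      induction t using List.reverseRecOn with
      | nil => simp at ht
      | append_singleton r a _ => exact ⟨r, a, b, by simp⟩
  cases b with
  | true => exact (hs [true, true, false, true] (by simp [trackPatterns])
      ⟨r ++ [a], [], by simp⟩).elim
  | false =>
    cases a with
    | true => exact (hs [true, false, true, false, true] (by simp [trackPatterns])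
        ⟨r, [], by simp⟩).elim
    | false => exact ⟨r, by simp⟩
end

section
/- For every binary string s and every basic block b ∈ {[0], [0,0,1], [0,0,1,1], [0,0,1,0,1]}, the concatenation s ++ b is non-tracking if and only if s is non-tracking. -/
/-- A string is non-tracking iff its reversal contains no reversed pattern. -/
theorem nonTracking_iff_reverse (s : List Bool) :
    NonTracking s ↔ ∀ p ∈ trackPatterns, ¬ p.reverse <:+: s.reverse := by
  simp only [NonTracking, List.reverse_infix]

/-- Appending a basic block preserves (and reflects) the non-tracking property. -/
theorem nonTracking_append_basicBlock (s : List Bool) (b : List Bool)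
    (hb : b ∈ basicBlocks) :
    NonTracking (s ++ b) ↔ NonTracking s := by
  rw [nonTracking_iff_reverse, nonTracking_iff_reverse, List.reverse_append]
  simp only [basicBlocks, List.mem_cons, List.not_mem_nil, or_false] at hb
  rcases hb with rfl | rfl | rfl | rfl <;>
    simp [trackPatterns, List.infix_cons_iff, List.cons_prefix_cons]
end

section
/- For every k, the number of initial-loss non-tracking binary strings of length k + 2 equals NTr(k), the number of non-tracking binary strings of length k; an explicit bijection is s ↦ [0,0] ++ s. -/
theorem bijOn_false_false_append (k : ℕ) :
    Set.BijOn (fun s : List Bool => [false, false] ++ s)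
      {s | s.length = k ∧ NonTracking s}
      {t | t.length = k + 2 ∧ NonTracking t ∧ InitialLoss t} := by
  refine ⟨fun s ⟨hk, hs⟩ => ?_, fun s _ t _ h => List.append_cancel_left h, ?_⟩
  · refine ⟨by simp [hk], by simpa [nonTracking_false_cons] using hs, fun i _ hi => ?_⟩
    interval_cases i <;> rfl
  · rintro t ⟨hk, ht, hloss⟩
    match t with
    | a :: b :: s =>
      obtain rfl : a = false := hloss 0 (by simp) (by simp)
      obtain rfl : b = false := hloss 1 (by simp) (by simp)
      exact ⟨s, ⟨by simpa using hk, by simpa [nonTracking_false_cons] using ht⟩, rfl⟩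

/-- The number of initial-loss non-tracking strings of length `k + 2` equals `NTr k`;
the map `s ↦ 00 ++ s` is an explicit bijection. -/
theorem card_initialLoss_nonTracking (k : ℕ) :
    Nat.card {t : List Bool // t.length = k + 2 ∧ NonTracking t ∧ InitialLoss t} = NTr k ∧
      Set.BijOn (fun s : List Bool => [false, false] ++ s)
        {s | s.length = k ∧ NonTracking s}
        {t | t.length = k + 2 ∧ NonTracking t ∧ InitialLoss t} :=
  ⟨(Nat.card_congr ((bijOn_false_false_append k).equiv _)).symm, bijOn_false_false_append k⟩
end

section
/- Every initial-loss non-tracking binary string is a concatenation of basic blocks, i.e., it equals the concatenation of a (possibly empty) list of strings each of which belongs to {[0], [0,0,1], [0,0,1,1], [0,0,1,0,1]}. -/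
theorem NonTracking.of_suffix {s t : List Bool} (hs : NonTracking s) (h : t <:+ s) :
    NonTracking t :=
  fun p hp hpt => hs p hp (hpt.trans h.isInfix)

theorem initialLoss_nil : InitialLoss [] := by
  simp [InitialLoss]

theorem initialLoss_singleton {a : Bool} : InitialLoss [a] ↔ a = false := by
  simp [InitialLoss]

theorem initialLoss_cons_cons {a b : Bool} {s : List Bool} :
    InitialLoss (a :: b :: s) ↔ a = false ∧ b = false := by
  constructor
  · intro h
    exact ⟨h 0 (by simp) (by simp), h 1 (by simp) (by simp)⟩
  · rintro ⟨rfl, rfl⟩ i - hi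
    interval_cases i <;> rfl

/-- A string that is not initial-loss starts with `1` or with `01`. -/
theorem exists_of_not_initialLoss {s : List Bool} (h : ¬ InitialLoss s) :
    (∃ t, s = true :: t) ∨ ∃ t, s = false :: true :: t := by
  match s with
  | [] => exact absurd initialLoss_nil h
  | true :: t => exact .inl ⟨t, rfl⟩
  | [false] => exact absurd (initialLoss_singleton.2 rfl) h
  | false :: true :: t => exact .inr ⟨t, rfl⟩
  | false :: false :: t => exact absurd (initialLoss_cons_cons.2 ⟨rfl, rfl⟩) h

/-- A nonempty initial-loss non-tracking string starts with a basic block whose removal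
leaves an initial-loss string. -/
theorem exists_basicBlock_append {s : List Bool} (hne : s ≠ [])
    (hIL : InitialLoss s) (hNT : NonTracking s) :
    ∃ b ∈ basicBlocks, ∃ t, InitialLoss t ∧ b ++ t = s := by
  have noPattern {p : List Bool} (hp : p ∈ trackPatterns) (u v : List Bool) :
      u ++ p ++ v ≠ s := fun h => hNT p hp ⟨u, v, h⟩
  match s with
  | [] => exact absurd rfl hne
  | [a] =>
    obtain rfl := initialLoss_singleton.1 hIL
    exact ⟨[false], by simp [basicBlocks], [], initialLoss_nil, rfl⟩
  | a :: b :: r =>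
    obtain ⟨rfl, rfl⟩ := initialLoss_cons_cons.1 hIL
    by_cases hr : InitialLoss (false :: r)
    · exact ⟨[false], by simp [basicBlocks], false :: r, hr, rfl⟩
    obtain ⟨t, ht⟩ | ⟨t, ht⟩ := exists_of_not_initialLoss hr
    · simp at ht
    obtain rfl : r = true :: t := by simpa using ht
    by_cases h1 : InitialLoss t
    · exact ⟨[false, false, true], by simp [basicBlocks], t, h1, rfl⟩
    obtain ⟨u, rfl⟩ | ⟨u, rfl⟩ := exists_of_not_initialLoss h1
    · refine ⟨[false, false, true, true], by simp [basicBlocks], u, ?_, rfl⟩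
      by_contra h2
      obtain ⟨v, rfl⟩ | ⟨v, rfl⟩ := exists_of_not_initialLoss h2
      · exact noPattern (p := [true, true, true]) (by simp [trackPatterns])
          [false, false] v rfl
      · exact noPattern (p := [true, true, false, true]) (by simp [trackPatterns])
          [false, false] v rfl
    · refine ⟨[false, false, true, false, true], by simp [basicBlocks], u, ?_, rfl⟩
      by_contra h2
      obtain ⟨v, rfl⟩ | ⟨v, rfl⟩ := exists_of_not_initialLoss h2
      · exact noPattern (p := [true, false, true, true]) (by simp [trackPatterns])
          [false, false] v rfl
      · exact noPattern (p := [true, false, true, false, true]) (by simp [trackPatterns])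
          [false, false] v rfl

theorem length_pos_of_mem_basicBlocks {b : List Bool} (hb : b ∈ basicBlocks) :
    0 < b.length := by
  revert b
  decide

/-- Every initial-loss non-tracking binary string is a concatenation of basic blocks. -/
theorem initialLoss_nonTracking_decomposition (s : List Bool)
    (hIL : InitialLoss s) (hNT : NonTracking s) :
    ∃ L : List (List Bool), (∀ b ∈ L, b ∈ basicBlocks) ∧ L.flatten = s := by
  induction hn : s.length using Nat.strong_induction_on generalizing s with
  | _ n ih =>
    by_cases hne : s = []
    · exact ⟨[], by simp, hne.symm⟩
    obtain ⟨b, hb, t, ht, rfl⟩ := exists_basicBlock_append hne hIL hNT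
    have hlt : t.length < n := by
      have := length_pos_of_mem_basicBlocks hb
      simp only [List.length_append] at hn
      omega
    obtain ⟨L, hL, rfl⟩ :=
      ih t.length hlt t ht (hNT.of_suffix (List.suffix_append b t)) rfl
    exact ⟨b :: L, List.forall_mem_cons.2 ⟨hb, hL⟩, rfl⟩
end

section
/- Every concatenation of basic blocks is an initial-loss non-tracking binary string: if L is a list of strings each belonging to {[0], [0,0,1], [0,0,1,1], [0,0,1,0,1]}, then the concatenation of L is non-tracking and initial-loss. -/
theorem initialLoss_iff {s : List Bool} :
    InitialLoss s ↔ s = [] ∨ s = [false] ∨ ∃ t, s = false :: false :: t := by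
  constructor
  · intro h
    match s, h with
    | [], _ => simp
    | [a], h => simpa using h 0 (by simp) (by simp)
    | a :: b :: t, h =>
      have ha : a = false := h 0 (by simp) (by simp)
      have hb : b = false := h 1 (by simp) (by simp)
      simp [ha, hb]
  · rintro (rfl | rfl | ⟨t, rfl⟩) i h hi <;> interval_cases i <;> first | rfl | simp at h

theorem NonTracking.basicBlock_append {b s : List Bool} (hb : b ∈ basicBlocks)
    (hs : NonTracking s) (hs' : InitialLoss s) : NonTracking (b ++ s) := by
  simp only [basicBlocks, List.mem_cons, List.not_mem_nil, or_false] at hb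
  rcases initialLoss_iff.1 hs' with rfl | rfl | ⟨t, rfl⟩ <;>
    rcases hb with rfl | rfl | rfl | rfl <;>
    simp_all [NonTracking, trackPatterns, List.infix_cons_iff, List.cons_prefix_cons]

theorem InitialLoss.basicBlock_append {b s : List Bool} (hb : b ∈ basicBlocks)
    (hs : InitialLoss s) : InitialLoss (b ++ s) := by
  simp only [basicBlocks, List.mem_cons, List.not_mem_nil, or_false] at hb
  rw [initialLoss_iff] at hs ⊢
  rcases hs with rfl | rfl | ⟨t, rfl⟩ <;> rcases hb with rfl | rfl | rfl | rfl <;> simp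

/-- Every concatenation of basic blocks is an initial-loss non-tracking binary string. -/
theorem flatten_basicBlocks_nonTracking_initialLoss (L : List (List Bool))
    (hL : ∀ b ∈ L, b ∈ basicBlocks) :
    NonTracking L.flatten ∧ InitialLoss L.flatten := by
  induction L with
  | nil => simp [NonTracking, trackPatterns, InitialLoss]
  | cons b L ih =>
    obtain ⟨hb, hL⟩ := List.forall_mem_cons.1 hL
    obtain ⟨hn, hi⟩ := ih hL
    exact ⟨hn.basicBlock_append hb hi, hi.basicBlock_append hb⟩
end

section
/- The decomposition of a string into basic blocks is unique: if L1 and L2 are lists of strings, each entry belonging to {[0], [0,0,1], [0,0,1,1], [0,0,1,0,1]}, and the concatenation of L1 equals the concatenation of L2, then L1 = L2. -/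
/-- The basic blocks form a suffix code: no block is a proper suffix of another. -/
theorem basicBlocks_eq_of_suffix :
    ∀ b ∈ basicBlocks, ∀ c ∈ basicBlocks, b <:+ c → b = c := by
  decide

theorem nil_notMem_basicBlocks : [] ∉ basicBlocks := by
  decide

/-- The decomposition into basic blocks is unique. -/
theorem basicBlocks_decomposition_unique (L1 L2 : List (List Bool))
    (h1 : ∀ b ∈ L1, b ∈ basicBlocks) (h2 : ∀ b ∈ L2, b ∈ basicBlocks)
    (h : L1.flatten = L2.flatten) : L1 = L2 := by
  induction L1 using List.reverseRecOn generalizing L2 with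
  | nil =>
    cases L2 with
    | nil => rfl
    | cons c L =>
      have hc : c = [] := by simp_all
      exact absurd (hc ▸ h2 c (by simp)) nil_notMem_basicBlocks
  | append_singleton L b ih =>
    have hb : b ∈ basicBlocks := h1 b (by simp)
    induction L2 using List.reverseRecOn with
    | nil =>
      have hb' : b = [] := by simp_all
      exact absurd (hb' ▸ hb) nil_notMem_basicBlocks
    | append_singleton M c _ =>
      have hc : c ∈ basicBlocks := h2 c (by simp)
      simp only [List.flatten_append, List.flatten_singleton] at h
      have hbc : b = c := by
        rcases List.suffix_or_suffix_of_suffix (List.suffix_append L.flatten b)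
          (h ▸ List.suffix_append M.flatten c) with hs | hs
        · exact basicBlocks_eq_of_suffix b hb c hc hs
        · exact (basicBlocks_eq_of_suffix c hc b hb hs).symm
      subst hbc
      rw [ih M (fun x hx => h1 x (by simp [hx])) (fun x hx => h2 x (by simp [hx]))
        (List.append_cancel_right h)]
end

section
/- If a binary string s equals the concatenation of a list of basic blocks b1, b2, …, bm, then the concatenation in reverse order bm, …, b2, b1 is also an initial-loss non-tracking binary string of the same length. -/
/-- A concatenation of basic blocks is empty, is `0`, or starts with `00`. -/
theorem flatten_basicBlocks_cases (L : List (List Bool)) (hL : ∀ b ∈ L, b ∈ basicBlocks) :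
    L.flatten = [] ∨ L.flatten = [false] ∨ ∃ t, L.flatten = false :: false :: t := by
  induction L with
  | nil => simp
  | cons b L ih =>
    rw [List.forall_mem_cons] at hL
    have hb := hL.1
    simp only [basicBlocks, List.mem_cons, List.not_mem_nil, or_false] at hb
    rcases hb with rfl | rfl | rfl | rfl <;> rcases ih hL.2 with h | h | ⟨t, h⟩ <;> simp [h]

theorem initialLoss_flatten_basicBlocks (L : List (List Bool))
    (hL : ∀ b ∈ L, b ∈ basicBlocks) : InitialLoss L.flatten := by
  have hc := flatten_basicBlocks_cases L hL
  generalize L.flatten = s at hc ⊢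
  intro i h hi
  rcases hc with rfl | rfl | ⟨t, rfl⟩ <;> interval_cases i <;>
    first | rfl | simp at h

theorem nonTracking_flatten_basicBlocks (L : List (List Bool))
    (hL : ∀ b ∈ L, b ∈ basicBlocks) : NonTracking L.flatten := by
  induction L with
  | nil => simp [NonTracking, trackPatterns]
  | cons b L ih =>
    rw [List.forall_mem_cons] at hL
    have hb := hL.1
    have hn := ih hL.2
    simp only [basicBlocks, List.mem_cons, List.not_mem_nil, or_false] at hb
    have hc := flatten_basicBlocks_cases L hL.2
    rw [List.flatten_cons]
    generalize L.flatten = s at hn hc ⊢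
    rcases hb with rfl | rfl | rfl | rfl <;> rcases hc with rfl | rfl | ⟨t, rfl⟩ <;>
      simp_all [NonTracking, trackPatterns, List.infix_cons_iff]

/-- Reversing the order of the basic blocks of a decomposition again yields an
initial-loss non-tracking string of the same length. -/
theorem reverse_blocks_nonTracking (s : List Bool) (L : List (List Bool))
    (hL : ∀ b ∈ L, b ∈ basicBlocks) (hs : s = L.flatten) :
    NonTracking L.reverse.flatten ∧ InitialLoss L.reverse.flatten ∧
      L.reverse.flatten.length = s.length := by
  have hR : ∀ b ∈ L.reverse, b ∈ basicBlocks := by simpa using hL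
  exact ⟨nonTracking_flatten_basicBlocks _ hR, initialLoss_flatten_basicBlocks _ hR, by
    simp [hs, List.length_flatten]⟩
end

section
/- For every n ≤ 4, any two tournaments on Fin n with the same score multiset are isomorphic. -/
/-- A tournament: an irreflexive relation such that for `i ≠ j` exactly one of
`r i j`, `r j i` holds. -/
def IsTournament {α : Type*} (r : α → α → Prop) : Prop :=
  (∀ i, ¬ r i i) ∧ ∀ i j : α, i ≠ j → Xor' (r i j) (r j i)

/-- The score of vertex `i`: the number of vertices `j` it beats. -/
noncomputable def score {α : Type*} [Fintype α] (r : α → α → Prop) (i : α) : ℕ :=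
  Nat.card {j : α // r i j}

/-- The score multiset of a tournament: the multiset of scores of all vertices. -/
noncomputable def scoreMultiset {α : Type*} [Fintype α] (r : α → α → Prop) : Multiset ℕ :=
  (Finset.univ : Finset α).val.map (score r)

/-- Two tournaments are isomorphic if some bijection of the vertices carries one
relation to the other. -/
def Isomorphic {α β : Type*} (r : α → α → Prop) (r' : β → β → Prop) : Prop :=
  ∃ e : α ≃ β, ∀ i j : α, r i j ↔ r' (e i) (e j)

/-- The dual tournament: all edges reversed. -/
def dualT {α : Type*} (r : α → α → Prop) : α → α → Prop :=
  fun i j => r j i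

/-- The composition `A + B`: within each summand play as before, and every vertex of
the second summand beats every vertex of the first. -/
def compT {α β : Type*} (A : α → α → Prop) (B : β → β → Prop) : α ⊕ β → α ⊕ β → Prop
  | Sum.inl i, Sum.inl j => A i j
  | Sum.inr i, Sum.inr j => B i j
  | Sum.inr _, Sum.inl _ => True
  | Sum.inl _, Sum.inr _ => False

theorem Isomorphic.symm {α β : Type*} {r : α → α → Prop} {r' : β → β → Prop}
    (h : Isomorphic r r') : Isomorphic r' r := by
  obtain ⟨e, he⟩ := h
  exact ⟨e.symm, fun i j => by simp [he]⟩

theorem Isomorphic.trans {α β γ : Type*} {r : α → α → Prop} {r' : β → β → Prop}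
    {r'' : γ → γ → Prop} (h : Isomorphic r r') (h' : Isomorphic r' r'') : Isomorphic r r'' := by
  obtain ⟨e, he⟩ := h
  obtain ⟨e', he'⟩ := h'
  exact ⟨e.trans e', fun i j => (he i j).trans (he' _ _)⟩

theorem Isomorphic.scoreMultiset_eq {α β : Type*} [Fintype α] [Fintype β] {r : α → α → Prop}
    {r' : β → β → Prop} (h : Isomorphic r r') : scoreMultiset r = scoreMultiset r' := by
  obtain ⟨e, he⟩ := h
  have hs : score r = score r' ∘ e :=
    funext fun i => Nat.card_congr (e.subtypeEquiv fun j => he i j)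
  rw [scoreMultiset, scoreMultiset, hs, ← Multiset.map_map, Multiset.map_univ_val_equiv]

/-- The tournament on `Fin n` whose edges are read off the binary digits of `m`: for `i < j`, the
edge goes from `i` to `j` if and only if the digit in position `j.choose 2 + i` is `1`. -/
def tournamentOfNat (n m : ℕ) (i j : Fin n) : Bool :=
  if i < j then m.testBit ((j : ℕ).choose 2 + i)
  else if j < i then !m.testBit ((i : ℕ).choose 2 + j)
  else false

theorem choose_two_add_lt {i j k : ℕ} (hij : i < j) (hjk : j < k) :
    j.choose 2 + i < k.choose 2 := by
  have h : (j + 1).choose 2 ≤ k.choose 2 := Nat.choose_le_choose 2 hjk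
  rw [Nat.choose_succ_succ' j 1, one_add_one_eq_two, Nat.choose_one_right] at h
  omega

theorem choose_two_add_inj {i j i' j' : ℕ} (hij : i < j) (hij' : i' < j')
    (h : j.choose 2 + i = j'.choose 2 + i') : i = i' ∧ j = j' := by
  rcases lt_trichotomy j j' with hj | rfl | hj
  · have := choose_two_add_lt hij hj
    omega
  · omega
  · have := choose_two_add_lt hij' hj
    omega

theorem IsTournament.exists_tournamentOfNat {n : ℕ} {r : Fin n → Fin n → Prop}
    (hr : IsTournament r) :
    ∃ m < 2 ^ n.choose 2, ∀ i j, r i j ↔ tournamentOfNat n m i j = true := by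
  classical
  let f : Fin (n.choose 2) → Bool := fun k =>
    decide (∃ i j : Fin n, i < j ∧ (k : ℕ) = (j : ℕ).choose 2 + i ∧ r i j)
  have hf (i j : Fin n) (hij : i < j) :
      (Nat.ofBits f).testBit ((j : ℕ).choose 2 + i) = true ↔ r i j := by
    rw [Nat.testBit_ofBits_lt f _ (choose_two_add_lt hij j.isLt), decide_eq_true_iff]
    constructor
    · rintro ⟨i', j', hij', hk, h⟩
      obtain ⟨hi, hj⟩ := choose_two_add_inj hij hij' hk
      rwa [Fin.ext hi, Fin.ext hj]
    · exact fun h => ⟨i, j, hij, rfl, h⟩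
  refine ⟨Nat.ofBits f, Nat.ofBits_lt_two_pow f, fun i j => ?_⟩
  rcases lt_trichotomy i j with h | rfl | h
  · simp [tournamentOfNat, h, hf]
  · simp [tournamentOfNat, hr.1]
  · have hx : r i j ↔ ¬ r j i := xor_iff_iff_not.mp (hr.2 i j h.ne')
    simp [tournamentOfNat, h, h.not_gt, hx, ← hf j i h]

/-- Codes, for `tournamentOfNat`, of one tournament on `n ≤ 4` vertices of each isomorphism
type. -/
def tournamentRepresentatives : ℕ → List ℕ
  | 3 => [0, 2]
  | 4 => [0, 2, 8, 16]
  | _ => [0]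

theorem exists_mem_tournamentRepresentatives : ∀ n ≤ 4, ∀ m < 2 ^ n.choose 2,
    ∃ c ∈ tournamentRepresentatives n, ∃ e : Equiv.Perm (Fin n),
      ∀ i j, tournamentOfNat n m i j = tournamentOfNat n c (e i) (e j) := by
  decide +kernel

theorem eq_of_mem_tournamentRepresentatives : ∀ n ≤ 4,
    ∀ c ∈ tournamentRepresentatives n, ∀ c' ∈ tournamentRepresentatives n,
      (Finset.univ : Finset (Fin n)).val.map
          (fun i => Fintype.card {j // tournamentOfNat n c i j = true}) =
        (Finset.univ : Finset (Fin n)).val.map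
          (fun i => Fintype.card {j // tournamentOfNat n c' i j = true}) →
      c = c' := by
  decide +kernel

/-- Tournaments on at most 4 vertices are determined by their score multiset. -/
theorem tournaments_le_four_unique (n : ℕ) (hn : n ≤ 4)
    (r r' : Fin n → Fin n → Prop) (hr : IsTournament r) (hr' : IsTournament r')
    (h : scoreMultiset r = scoreMultiset r') : Isomorphic r r' := by
  have key (s : Fin n → Fin n → Prop) (hs : IsTournament s) :
      ∃ c ∈ tournamentRepresentatives n,
        Isomorphic s (fun i j => tournamentOfNat n c i j = true) := by
    obtain ⟨m, hm, hsm⟩ := hs.exists_tournamentOfNat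
    obtain ⟨c, hc, e, he⟩ := exists_mem_tournamentRepresentatives n hn m hm
    exact ⟨c, hc, e, fun i j => by rw [hsm, he]⟩
  obtain ⟨c, hc, hrc⟩ := key r hr
  obtain ⟨c', hc', hrc'⟩ := key r' hr'
  rw [hrc.scoreMultiset_eq, hrc'.scoreMultiset_eq] at h
  have hs (m : ℕ) : score (fun i j => tournamentOfNat n m i j = true) =
      fun i => Fintype.card {j // tournamentOfNat n m i j = true} :=
    funext fun _ => Nat.card_eq_fintype_card
  rw [scoreMultiset, scoreMultiset, hs, hs] at h
  obtain rfl := eq_of_mem_tournamentRepresentatives n hn c hc c' hc' h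
  exact hrc.trans hrc'.symm
end

section
/- Every basic tournament is self-dual: any tournament on Fin 1 with score multiset {0}, any tournament on Fin 3 with score multiset {1,1,1}, any tournament on Fin 4 with score multiset {1,1,2,2}, and any tournament on Fin 5 with score multiset {2,2,2,2,2} is isomorphic to its dual tournament. -/
theorem score_eq_sum_toNat {α : Type*} [Fintype α] (r : α → α → Prop) [DecidableRel r] (i : α) :
    score r i = ∑ j, (decide (r i j)).toNat := by
  rw [score, Nat.card_eq_fintype_card, Fintype.card_subtype, Finset.card_filter]
  refine Finset.sum_congr rfl fun j _ => ?_
  by_cases hr : r i j <;> simp [hr]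

theorem score_eq_of_scoreMultiset_eq_replicate {α : Type*} [Fintype α] {r : α → α → Prop}
    {n k : ℕ} (h : scoreMultiset r = Multiset.replicate n k) (i : α) : score r i = k :=
  Multiset.eq_of_mem_replicate
    (h.subst (Multiset.mem_map_of_mem (score r) (Finset.mem_univ_val i)))

theorem IsTournament.rel_swap {α : Type*} {r : α → α → Prop} (h : IsTournament r) {i j : α}
    (hij : i ≠ j) : r i j ↔ ¬r j i :=
  xor_iff_iff_not.1 (h.2 i j hij)

/-- A bijection reverses a tournament on a linearly ordered type as soon as it reverses the
arcs between pairs `i < j`. -/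
theorem IsTournament.isomorphic_dualT {α : Type*} [LinearOrder α] {r : α → α → Prop}
    (h : IsTournament r) (e : α ≃ α) (he : ∀ i j, i < j → (r i j ↔ r (e j) (e i))) :
    Isomorphic r (dualT r) := by
  refine ⟨e, fun i j => ?_⟩
  rcases lt_trichotomy i j with hij | rfl | hij
  · exact he i j hij
  · simp [dualT, h.1]
  · rw [dualT, h.rel_swap hij.ne', h.rel_swap (e.injective.ne hij.ne), he j i hij]

theorem IsTournament.isomorphic_dualT_of_regular_three {r : Fin 3 → Fin 3 → Prop}
    (h : IsTournament r) (hs : ∀ i, score r i = 1) : Isomorphic r (dualT r) := by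
  have key : ∀ a b c : Bool, a.toNat + b.toNat = 1 → (!a).toNat + c.toNat = 1 → b = !c := by
    decide
  classical
  have h₁₀ := h.rel_swap (i := 1) (j := 0) (by decide)
  have h₂₀ := h.rel_swap (i := 2) (j := 0) (by decide)
  have h₂₁ := h.rel_swap (i := 2) (j := 1) (by decide)
  have h₀ := hs 0
  have h₁ := hs 1
  simp only [score_eq_sum_toNat, Fin.sum_univ_three, h.1, decide_false, Bool.toNat_false,
    zero_add, add_zero, decide_not, h₁₀] at h₀ h₁
  have hk := key _ _ _ h₀ h₁
  simp only [← decide_not, decide_eq_decide] at hk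
  refine h.isomorphic_dualT (Equiv.swap 0 1) fun i j hij => ?_
  fin_cases i <;> fin_cases j <;> simp [Equiv.swap_apply_def] at hij ⊢ <;>
      simp only [hk, not_not, h₂₀, h₂₁]

theorem IsTournament.isomorphic_dualT_of_scoreMultiset_four {r : Fin 4 → Fin 4 → Prop}
    (h : IsTournament r) (hs : scoreMultiset r = {1, 1, 2, 2}) : Isomorphic r (dualT r) := by
  have key : ∀ a b c d e f : Bool,
      ({a.toNat + b.toNat + c.toNat, (!a).toNat + d.toNat + e.toNat,
        (!b).toNat + (!d).toNat + f.toNat, (!c).toNat + (!e).toNat + (!f).toNat} : Multiset ℕ)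
        = {1, 1, 2, 2} →
      (b = !e ∧ c = !d) ∨ (a = !f ∧ c = d) ∨ (a = f ∧ b = e) := by decide
  classical
  have hm : scoreMultiset r = {score r 0, score r 1, score r 2, score r 3} := rfl
  have h₁₀ := h.rel_swap (i := 1) (j := 0) (by decide)
  have h₂₀ := h.rel_swap (i := 2) (j := 0) (by decide)
  have h₃₀ := h.rel_swap (i := 3) (j := 0) (by decide)
  have h₂₁ := h.rel_swap (i := 2) (j := 1) (by decide)
  have h₃₁ := h.rel_swap (i := 3) (j := 1) (by decide)
  have h₃₂ := h.rel_swap (i := 3) (j := 2) (by decide)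
  rw [hm] at hs
  simp only [score_eq_sum_toNat, Fin.sum_univ_four, h.1, decide_false, Bool.toNat_false,
    zero_add, add_zero, decide_not, h₁₀, h₂₀, h₃₀, h₂₁, h₃₁, h₃₂] at hs
  have hk := key _ _ _ _ _ _ hs
  simp only [← decide_not, decide_eq_decide] at hk
  rcases hk with hk | hk | hk
  · refine h.isomorphic_dualT (Equiv.swap 0 1 * Equiv.swap 2 3) fun i j hij => ?_
    fin_cases i <;> fin_cases j <;> simp [Equiv.swap_apply_def] at hij ⊢ <;>
      simp only [hk, not_not, h₂₀, h₃₀, h₂₁, h₃₁]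
  · refine h.isomorphic_dualT (Equiv.swap 0 2 * Equiv.swap 1 3) fun i j hij => ?_
    fin_cases i <;> fin_cases j <;> simp [Equiv.swap_apply_def] at hij ⊢ <;>
      simp only [hk, not_not, h₁₀, h₃₂]
  · refine h.isomorphic_dualT (Equiv.swap 0 3 * Equiv.swap 1 2) fun i j hij => ?_
    fin_cases i <;> fin_cases j <;> simp [Equiv.swap_apply_def] at hij ⊢ <;>
      simp only [hk]

set_option synthInstance.maxSize 1000 in
theorem IsTournament.isomorphic_dualT_of_regular_five {r : Fin 5 → Fin 5 → Prop}
    (h : IsTournament r) (hs : ∀ i, score r i = 2) : Isomorphic r (dualT r) := by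
  have key : ∀ a b c d : Bool, a.toNat + b.toNat + c.toNat + d.toNat = 2 →
      ∀ e f g : Bool, (!a).toNat + e.toNat + f.toNat + g.toNat = 2 →
      ∀ p q : Bool, (!b).toNat + (!e).toNat + p.toNat + q.toNat = 2 →
      ∀ s : Bool, (!c).toNat + (!f).toNat + (!p).toNat + s.toNat = 2 →
      (a = !b ∧ c = !d ∧ f = !q ∧ g = !p) ∨ (a = !c ∧ b = !d ∧ e = !s ∧ g = p) ∨
      (a = !d ∧ b = !c ∧ e = s ∧ f = q) := by decide
  classical
  have h₁₀ := h.rel_swap (i := 1) (j := 0) (by decide)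
  have h₂₀ := h.rel_swap (i := 2) (j := 0) (by decide)
  have h₃₀ := h.rel_swap (i := 3) (j := 0) (by decide)
  have h₄₀ := h.rel_swap (i := 4) (j := 0) (by decide)
  have h₂₁ := h.rel_swap (i := 2) (j := 1) (by decide)
  have h₃₁ := h.rel_swap (i := 3) (j := 1) (by decide)
  have h₄₁ := h.rel_swap (i := 4) (j := 1) (by decide)
  have h₃₂ := h.rel_swap (i := 3) (j := 2) (by decide)
  have h₄₂ := h.rel_swap (i := 4) (j := 2) (by decide)
  have h₄₃ := h.rel_swap (i := 4) (j := 3) (by decide)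
  have h₀ := hs 0
  have h₁ := hs 1
  have h₂ := hs 2
  have h₃ := hs 3
  simp only [score_eq_sum_toNat, Fin.sum_univ_five, h.1, decide_false, Bool.toNat_false,
    zero_add, add_zero, decide_not, h₁₀, h₂₀, h₃₀, h₂₁, h₃₁, h₃₂] at h₀ h₁ h₂ h₃
  have hk := key _ _ _ _ h₀ _ _ _ h₁ _ _ h₂ _ h₃
  simp only [← decide_not, decide_eq_decide] at hk
  rcases hk with hk | hk | hk
  · refine h.isomorphic_dualT (Equiv.swap 1 2 * Equiv.swap 3 4) fun i j hij => ?_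
    fin_cases i <;> fin_cases j <;> simp [Equiv.swap_apply_def] at hij ⊢ <;>
      simp only [hk, not_not, h₁₀, h₂₀, h₃₀, h₄₀, h₃₁, h₄₁, h₃₂, h₄₂]
  · refine h.isomorphic_dualT (Equiv.swap 1 3 * Equiv.swap 2 4) fun i j hij => ?_
    fin_cases i <;> fin_cases j <;> simp [Equiv.swap_apply_def] at hij ⊢ <;>
      simp only [hk, not_not, h₁₀, h₂₀, h₃₀, h₄₀, h₂₁, h₄₃]
  · refine h.isomorphic_dualT (Equiv.swap 1 4 * Equiv.swap 2 3) fun i j hij => ?_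
    fin_cases i <;> fin_cases j <;> simp [Equiv.swap_apply_def] at hij ⊢ <;>
      simp only [hk, not_not, h₁₀, h₂₀, h₃₀, h₄₀]

/-- Every basic tournament is self-dual. -/
theorem basic_tournaments_self_dual :
    (∀ r : Fin 1 → Fin 1 → Prop, IsTournament r →
      scoreMultiset r = ({0} : Multiset ℕ) → Isomorphic r (dualT r)) ∧
    (∀ r : Fin 3 → Fin 3 → Prop, IsTournament r →
      scoreMultiset r = ({1, 1, 1} : Multiset ℕ) → Isomorphic r (dualT r)) ∧
    (∀ r : Fin 4 → Fin 4 → Prop, IsTournament r →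
      scoreMultiset r = ({1, 1, 2, 2} : Multiset ℕ) → Isomorphic r (dualT r)) ∧
    (∀ r : Fin 5 → Fin 5 → Prop, IsTournament r →
      scoreMultiset r = ({2, 2, 2, 2, 2} : Multiset ℕ) → Isomorphic r (dualT r)) := by
  refine ⟨fun r h _ => h.isomorphic_dualT (Equiv.refl _) (by simp [Subsingleton.elim _ (0 : Fin 1)]),
    fun r h hs => h.isomorphic_dualT_of_regular_three
      (score_eq_of_scoreMultiset_eq_replicate (n := 3) hs),
    fun r h hs => h.isomorphic_dualT_of_scoreMultiset_four hs,
    fun r h hs => h.isomorphic_dualT_of_regular_five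
      (score_eq_of_scoreMultiset_eq_replicate (n := 5) hs)⟩
end
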